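/- arXiv:0906.2424 — 2 statements merged into one kernel-verified Lean document; each statement's English description precedes it below -/
import Mathlib

section
/- Let S ⊆ ℂⁿ × ℂᵐ be a compact set whose projection π(S) is contained in ℝⁿ, and assume that for every u ∈ π(S) the fiber S_u ⊆ ℂᵐ is O(ℂᵐ)-convex (equal to its hull with respect to entire functions on ℂᵐ). Then S is O(ℂⁿ × ℂᵐ)-convex: S equals its hull with respect to entire functions on ℂⁿ × ℂᵐ. In particular, S is a Stein compactum in ℂⁿ × ℂᵐ. -/
open Set Topology

noncomputable section

/-- The `𝒪(Ω)`-hull of a set `K` inside `Ω`: points of `Ω` where every function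
holomorphic on `Ω` is bounded by its sup over `K`. -/
def hullO {E : Type*} [NormedAddCommGroup E] [NormedSpace ℂ E] (Ω K : Set E) : Set E :=
  {z ∈ Ω | ∀ f : E → ℂ, DifferentiableOn ℂ f Ω → ‖f z‖ ≤ ⨆ w ∈ K, ‖f w‖}

/-- An open set is Stein if the `𝒪(Ω)`-hull of every compact subset is compact. -/
def IsSteinOpen {E : Type*} [NormedAddCommGroup E] [NormedSpace ℂ E] (Ω : Set E) : Prop :=
  IsOpen Ω ∧ ∀ K : Set E, K ⊆ Ω → IsCompact K → IsCompact (hullO Ω K)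

/-- A compact set is a Stein compactum if every open neighborhood contains a
Stein open neighborhood. -/
def IsSteinCompactum {E : Type*} [NormedAddCommGroup E] [NormedSpace ℂ E] (S : Set E) : Prop :=
  ∀ U : Set E, IsOpen U → S ⊆ U → ∃ Ω : Set E, IsSteinOpen Ω ∧ S ⊆ Ω ∧ Ω ⊆ U

/-- `ℝⁿ` viewed as the real subspace of `ℂⁿ`. -/
def realSlice (n : ℕ) : Set (EuclideanSpace ℂ (Fin n)) := {x | ∀ i, (x i).im = 0}

/-- The fiber of a subset of a product over a point of the first factor. -/
def fiberOf {α β : Type*} (S : Set (α × β)) (u : α) : Set β := {z | (u, z) ∈ S}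

/-- A subset of `ℝⁿ × ℂᵐ` that is open in the subspace topology of `ℝⁿ × ℂᵐ ⊆ ℂⁿ × ℂᵐ`. -/
def OpenInSlice {n m : ℕ}
    (U : Set (EuclideanSpace ℂ (Fin n) × EuclideanSpace ℂ (Fin m))) : Prop :=
  ∃ W, IsOpen W ∧ U = W ∩ (realSlice n ×ˢ (univ : Set (EuclideanSpace ℂ (Fin m))))


theorem hullO_bound {E : Type*} [NormedAddCommGroup E] [NormedSpace ℂ E] {Ω K : Set E} {z : E}
    (hz : z ∈ hullO Ω K) {f : E → ℂ} (hf : DifferentiableOn ℂ f Ω) {r : ℝ} (hr : 0 ≤ r)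
    (h : ∀ w ∈ K, ‖f w‖ ≤ r) : ‖f z‖ ≤ r :=
  (hz.2 f hf).trans (Real.iSup_le (fun w => Real.iSup_le (fun hw => h w hw) hr) hr)

theorem le_sup_of_mem {E : Type*} [NormedAddCommGroup E] [NormedSpace ℂ E] {K : Set E}
    (hK : IsCompact K) {f : E → ℂ} (hf : ContinuousOn f K) {w : E} (hw : w ∈ K) :
    ‖f w‖ ≤ ⨆ w ∈ K, ‖f w‖ := by
  obtain ⟨C, hC⟩ := hK.exists_bound_of_continuousOn hf
  have hb : BddAbove (range fun w => ⨆ (_ : w ∈ K), ‖f w‖) := by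
    refine ⟨max C 0, ?_⟩
    rintro _ ⟨v, rfl⟩
    exact Real.iSup_le (fun hv => (hC v hv).trans (le_max_left _ _)) (le_max_right _ _)
  have h := le_ciSup hb w
  simpa [hw] using h

theorem subset_hullO {E : Type*} [NormedAddCommGroup E] [NormedSpace ℂ E] {Ω K : Set E}
    (hK : IsCompact K) (hKΩ : K ⊆ Ω) : K ⊆ hullO Ω K := fun _ hw =>
  ⟨hKΩ hw, fun _ hf => le_sup_of_mem hK (hf.continuousOn.mono hKΩ) hw⟩

theorem exists_sep {E : Type*} [NormedAddCommGroup E] [NormedSpace ℂ E] {K : Set E}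
    (hK : IsCompact K) {z : E} (hz : z ∉ hullO univ K) :
    ∃ f : E → ℂ, Differentiable ℂ f ∧ ∃ c : ℝ, 0 < c ∧ (∀ w ∈ K, ‖f w‖ < c) ∧ c < ‖f z‖ := by
  simp only [hullO, mem_ofPred_eq, mem_univ, true_and, not_forall, not_le] at hz
  obtain ⟨f, hf, h⟩ := hz
  obtain ⟨c, h1, h2⟩ := exists_between h
  have h0 : (0 : ℝ) ≤ ⨆ w ∈ K, ‖f w‖ :=
    Real.iSup_nonneg fun _ => Real.iSup_nonneg fun _ => norm_nonneg _
  exact ⟨f, differentiableOn_univ.1 hf, c, h0.trans_lt h1, fun w hw =>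
    (le_sup_of_mem hK (hf.continuousOn.mono (subset_univ _)) hw).trans_lt h1, h2⟩

theorem exists_lt_bound {E : Type*} [TopologicalSpace E] {K : Set E} (hK : IsCompact K)
    {g : E → ℝ} (hg : ContinuousOn g K) {R : ℝ} (hR : 0 < R) (h : ∀ w ∈ K, g w < R) :
    ∃ r, 0 ≤ r ∧ r < R ∧ ∀ w ∈ K, g w ≤ r := by
  rcases K.eq_empty_or_nonempty with rfl | hne
  · exact ⟨0, le_rfl, hR, by simp⟩
  · obtain ⟨x, hx, hm⟩ := hK.exists_isMaxOn hne hg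
    exact ⟨max (g x) 0, le_max_right _ _, max_lt (h x hx) hR,
      fun w hw => (hm hw).trans (le_max_left _ _)⟩

theorem stein_of_convex {E : Type*} [NormedAddCommGroup E] [NormedSpace ℂ E] [ProperSpace E]
    {S : Set E} (hS : IsCompact S) (hc : hullO univ S = S) : IsSteinCompactum S := by
  intro U hU hSU
  obtain ⟨R, hR, hSR⟩ : ∃ R : ℝ, 0 < R ∧ ∀ w ∈ S, ‖w‖ < R := by
    obtain ⟨C, hC⟩ := hS.exists_bound_of_continuousOn (f := id) continuousOn_id
    exact ⟨max C 0 + 1, by positivity, fun w hw =>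
      ((hC w hw).trans (le_max_left _ _)).trans_lt (lt_add_one _)⟩
  have hB : IsCompact (Metric.closedBall (0 : E) R \ U) := (isCompact_closedBall _ _).diff hU
  have hsep : ∀ p : E, ∃ f : E → ℂ, ∃ c : ℝ, Differentiable ℂ f ∧ 0 < c ∧
      (∀ w ∈ S, ‖f w‖ < c) ∧ (p ∉ S → c < ‖f p‖) := by
    intro p
    by_cases hp : p ∈ S
    · exact ⟨fun _ => 0, 1, by fun_prop, one_pos, by simp, fun h => (h hp).elim⟩
    · obtain ⟨f, hf, c, h0, h1, h2⟩ := exists_sep hS (z := p) (by rwa [hc])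
      exact ⟨f, c, hf, h0, h1, fun _ => h2⟩
  choose F c hF hc0 hFS hFp using hsep
  obtain ⟨t, -, ht⟩ := hB.elim_nhds_subcover (fun p => {q | c p < ‖F p q‖}) (fun p hp =>
    (isOpen_lt continuous_const (hF p).continuous.norm).mem_nhds
      (hFp p fun h => hp.2 (hSU h)))
  refine ⟨Metric.ball 0 R ∩ ⋂ p ∈ t, {q | ‖F p q‖ < c p}, ⟨?_, ?_⟩, ?_, ?_⟩
  · exact Metric.isOpen_ball.inter (isOpen_biInter_finset fun p _ =>
      isOpen_lt (hF p).continuous.norm continuous_const)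
  · intro K hKΩ hK
    obtain ⟨r, hr0, hrR, hr⟩ := exists_lt_bound hK continuous_norm.continuousOn hR
      (fun w hw => by simpa using (hKΩ hw).1)
    have hρ : ∀ p : E, ∃ ρ : ℝ, p ∈ t → 0 ≤ ρ ∧ ρ < c p ∧ ∀ w ∈ K, ‖F p w‖ ≤ ρ := by
      intro p
      by_cases hp : p ∈ t
      · obtain ⟨ρ, h⟩ := exists_lt_bound hK (hF p).continuous.norm.continuousOn (hc0 p)
          (fun w hw => by
            have := (hKΩ hw).2
            simp only [mem_iInter] at this
            exact this p hp)
        exact ⟨ρ, fun _ => h⟩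
      · exact ⟨0, fun h => (hp h).elim⟩
    choose ρ hρ using hρ
    set Ω := Metric.ball (0 : E) R ∩ ⋂ p ∈ t, {q | ‖F p q‖ < c p} with hΩ
    set C := Metric.closedBall (0 : E) r ∩ ⋂ p ∈ t, {q | ‖F p q‖ ≤ ρ p} with hCdef
    have hCc : IsCompact C := (isCompact_closedBall _ _).inter_right
      (isClosed_biInter fun p _ => isClosed_le (hF p).continuous.norm continuous_const)
    have hCΩ : C ⊆ Ω := by
      rintro q ⟨h1, h2⟩
      simp only [mem_iInter] at h2
      refine ⟨Metric.closedBall_subset_ball hrR h1, ?_⟩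
      simp only [mem_iInter]
      exact fun p hp => lt_of_le_of_lt (h2 p hp) (hρ p hp).2.1
    have hsub : hullO Ω K ⊆ C := by
      intro z hz
      refine ⟨?_, ?_⟩
      · obtain ⟨g, hg, hgz⟩ := exists_dual_vector'' ℂ z
        have h := hullO_bound hz (f := g) g.differentiable.differentiableOn hr0 (fun w hw =>
          ((g.le_of_opNorm_le hg w).trans (by simpa using hr w hw)))
        rw [hgz] at h
        simpa using h
      · simp only [mem_iInter]
        exact fun p hp => hullO_bound hz (hF p).differentiableOn (hρ p hp).1 (hρ p hp).2.2
    refine hCc.of_isClosed_subset ?_ hsub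
    have : hullO Ω K = C ∩ ⋂ f : {f : E → ℂ // DifferentiableOn ℂ f Ω},
        (C ∩ (fun z => ‖f.1 z‖) ⁻¹' Iic (⨆ w ∈ K, ‖f.1 w‖)) := by
      ext z
      constructor
      · exact fun hz => ⟨hsub hz, mem_iInter.2 fun f => ⟨hsub hz, hz.2 f.1 f.2⟩⟩
      · exact fun hz => ⟨hCΩ hz.1, fun f hf => (mem_iInter.1 hz.2 ⟨f, hf⟩).2⟩
    rw [this]
    exact hCc.isClosed.inter (isClosed_iInter fun f =>
      (f.2.continuousOn.mono hCΩ).norm.preimage_isClosed_of_isClosed hCc.isClosed isClosed_Iic)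
  · intro w hw
    refine ⟨by simpa using hSR w hw, ?_⟩
    simp only [mem_iInter]
    exact fun p _ => hFS p w hw
  · rintro q ⟨h1, h2⟩
    by_contra hq
    have := ht ⟨Metric.ball_subset_closedBall h1, hq⟩
    simp only [mem_iUnion, mem_iInter, mem_ofPred_eq, exists_prop] at this h2
    obtain ⟨p, hp, h⟩ := this
    exact lt_asymm h (h2 p hp)

theorem hull_eq_of_fibers {n m : ℕ}
    (S : Set (EuclideanSpace ℂ (Fin n) × EuclideanSpace ℂ (Fin m)))
    (hS : IsCompact S) (hP : Prod.fst '' S ⊆ realSlice n)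
    (hfib : ∀ u ∈ Prod.fst '' S, hullO univ (fiberOf S u) = fiberOf S u) :
    hullO univ S = S := by
  refine Subset.antisymm ?_ (subset_hullO hS (subset_univ _))
  rintro ⟨u, z⟩ hz
  have hP' : ∀ p ∈ S, ∀ i, (p.1 i).im = 0 := fun p hp => hP ⟨p, hp, rfl⟩
  have hco : ∀ i, Differentiable ℂ
      (fun p : EuclideanSpace ℂ (Fin n) × EuclideanSpace ℂ (Fin m) => p.1 i) := fun i =>
    (((EuclideanSpace.proj i : EuclideanSpace ℂ (Fin n) →L[ℂ] ℂ).comp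
      (ContinuousLinearMap.fst ℂ _ (EuclideanSpace ℂ (Fin m))))).differentiable
  have hu : ∀ i, (u i).im = 0 := by
    intro i
    have key : ∀ a : ℂ, a.re = 0 → -(a.im * (u i).im) ≤ 0 := by
      intro a ha
      have h := hullO_bound hz (f := fun p => Complex.exp (a * p.1 i))
        (Differentiable.cexp ((hco i).const_mul a)).differentiableOn zero_le_one (fun w hw => by
          simp [Complex.norm_exp, ha, hP' w hw i])
      simpa [Complex.norm_exp, ha] using h
    have h1 := key Complex.I (by simp)
    have h2 := key (-Complex.I) (by simp)
    simp at h1 h2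
    linarith
  by_contra hns
  have hfc : IsCompact (fiberOf S u) := by
    have : fiberOf S u = Prod.snd '' (S ∩ Prod.fst ⁻¹' {u}) := by
      ext w
      simp [fiberOf]
    rw [this]
    exact (hS.inter_right (isClosed_singleton.preimage continuous_fst)).image continuous_snd
  have hzf : z ∉ hullO univ (fiberOf S u) := by
    by_cases h : u ∈ Prod.fst '' S
    · rw [hfib u h]; exact hns
    · intro hz'
      have he : ∀ w ∈ fiberOf S u, ‖(1 : ℂ)‖ ≤ 0 := fun w hw => (h ⟨(u, w), hw, rfl⟩).elim
      have := hullO_bound hz' (f := fun _ => 1) (by fun_prop) le_rfl he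
      simp at this
      linarith
  obtain ⟨h, hh, c, hc0, hcf, hcz⟩ := exists_sep hfc hzf
  have hhc := hh.continuous
  -- the real quadratic distance
  let d : EuclideanSpace ℂ (Fin n) × EuclideanSpace ℂ (Fin m) → ℝ :=
    fun p => ∑ i, ((p.1 i).re - (u i).re) ^ 2
  have hdc : Continuous d := by fun_prop
  have hd0 : ∀ p, 0 ≤ d p := fun p => Finset.sum_nonneg fun i _ => sq_nonneg _
  have hK1 : IsCompact (S ∩ {p | c ≤ ‖h p.2‖}) :=
    hS.inter_right (isClosed_le continuous_const (by fun_prop))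
  obtain ⟨δ, hδ, hδK⟩ : ∃ δ : ℝ, 0 < δ ∧ ∀ p ∈ S, c ≤ ‖h p.2‖ → δ ≤ d p := by
    rcases (S ∩ {p | c ≤ ‖h p.2‖}).eq_empty_or_nonempty with he | hne
    · exact ⟨1, one_pos, fun p hp hp' => (notMem_empty p (he ▸ ⟨hp, hp'⟩)).elim⟩
    · obtain ⟨q, hq, hm⟩ := hK1.exists_isMinOn hne hdc.continuousOn
      refine ⟨d q, lt_of_le_of_ne (hd0 q) ?_, fun p hp hp' => hm ⟨hp, hp'⟩⟩
      intro h0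
      have hqu : q.1 = u := by
        ext i
        have := (Finset.sum_eq_zero_iff_of_nonneg (fun i _ => sq_nonneg _)).1 h0.symm i
          (Finset.mem_univ i)
        apply Complex.ext
        · exact sub_eq_zero.1 (pow_eq_zero_iff two_ne_zero |>.1 this)
        · rw [hP' q hq.1 i, hu i]
      have hqf : q.2 ∈ fiberOf S u := by
        have : (q.1, q.2) ∈ S := hq.1
        rwa [hqu] at this
      exact absurd (hcf _ hqf) (not_lt.2 hq.2)
  obtain ⟨M, hM⟩ := hS.exists_bound_of_continuousOn (f := fun p => h p.2)
    (by fun_prop)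
  obtain ⟨N, hN⟩ : ∃ N : ℕ, M * Real.exp (-δ) ^ N < c := by
    have := (tendsto_pow_atTop_nhds_zero_of_lt_one (Real.exp_pos (-δ)).le
      (by simpa using hδ)).const_mul M
    rw [mul_zero] at this
    exact (this.eventually (gt_mem_nhds hc0)).exists
  have hnorm : ∀ p : EuclideanSpace ℂ (Fin n) × EuclideanSpace ℂ (Fin m),
      (∀ i, (p.1 i).im = 0) →
      ‖h p.2 * Complex.exp (-∑ i, (p.1 i - u i) ^ 2) ^ N‖ = ‖h p.2‖ * Real.exp (-d p) ^ N := by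
    intro p hp
    rw [norm_mul, norm_pow, Complex.norm_exp]
    simp [d, pow_two, hp, hu]
  have hdiff : Differentiable ℂ
      (fun p : EuclideanSpace ℂ (Fin n) × EuclideanSpace ℂ (Fin m) =>
        h p.2 * Complex.exp (-∑ i, (p.1 i - u i) ^ 2) ^ N) := by
    have h1 : Differentiable ℂ
        (fun p : EuclideanSpace ℂ (Fin n) × EuclideanSpace ℂ (Fin m) => h p.2) :=
      hh.comp differentiable_snd
    have h2 : Differentiable ℂ
        (fun p : EuclideanSpace ℂ (Fin n) × EuclideanSpace ℂ (Fin m) =>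
          ∑ i, (p.1 i - u i) ^ 2) :=
      Differentiable.fun_sum fun i _ => ((hco i).sub_const (u i)).fun_pow 2
    exact h1.fun_mul (h2.fun_neg.cexp.fun_pow N)
  have hfin := hullO_bound hz
    (f := fun p => h p.2 * Complex.exp (-∑ i, (p.1 i - u i) ^ 2) ^ N) hdiff.differentiableOn hc0.le
    (fun p hp => by
      rw [hnorm p (hP' p hp)]
      by_cases hpc : c ≤ ‖h p.2‖
      · have h1 : Real.exp (-d p) ≤ Real.exp (-δ) :=
          Real.exp_le_exp.2 (neg_le_neg (hδK p hp hpc))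
        calc ‖h p.2‖ * Real.exp (-d p) ^ N ≤ ‖h p.2‖ * Real.exp (-δ) ^ N := by gcongr
          _ ≤ M * Real.exp (-δ) ^ N := by
              gcongr
              exact hM p hp
          _ ≤ c := hN.le
      · have h1 : Real.exp (-d p) ^ N ≤ 1 :=
          pow_le_one₀ (Real.exp_pos _).le (Real.exp_le_one_iff.2 (neg_nonpos.2 (hd0 p)))
        exact (mul_le_of_le_one_right (norm_nonneg _) h1).trans (not_le.1 hpc).le)
  rw [hnorm (u, z) hu] at hfin
  simp [d] at hfin
  linarith

/-- Remark after Example 1.2: if `S ⊆ ℂⁿ × ℂᵐ` is compact, fibered over `ℝⁿ`, and every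
fiber `S_u` is `𝒪(ℂᵐ)`-convex, then `S` is `𝒪(ℂⁿ × ℂᵐ)`-convex, and in particular a
Stein compactum. -/
theorem polynomially_convex_of_convex_fibers {n m : ℕ}
    (S : Set (EuclideanSpace ℂ (Fin n) × EuclideanSpace ℂ (Fin m)))
    (hS : IsCompact S) (hP : Prod.fst '' S ⊆ realSlice n)
    (hfib : ∀ u ∈ Prod.fst '' S, hullO univ (fiberOf S u) = fiberOf S u) :
    hullO univ S = S ∧ IsSteinCompactum S := by
  have h := hull_eq_of_fibers S hS hP hfib
  exact ⟨h, stein_of_convex hS h⟩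
end
end

section
/- For every point u₀ ∈ ℝⁿ ⊆ ℂⁿ and every δ > 0 there exists an entire function h : ℂⁿ → ℂ such that h(u₀) = 0, ‖h(x)‖ ≤ 1/2 for every x ∈ ℝⁿ with ‖x − u₀‖ ≤ δ, and 1/3 < ‖h(x)‖ < 1/2 for every x ∈ ℝⁿ with ‖x − u₀‖ > δ. -/
open Set Topology

noncomputable section

/-- The auxiliary entire function used in the proof of Lemma 1.6: for `u₀ ∈ ℝⁿ` and
`δ > 0` there is an entire function `h` on `ℂⁿ` vanishing at `u₀`, with `‖h‖ ≤ 1/2` on the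
real ball `‖x - u₀‖ ≤ δ` and `1/3 < ‖h‖ < 1/2` on the rest of `ℝⁿ`. -/
theorem exists_entire_cutoff {n : ℕ}
    (u₀ : EuclideanSpace ℂ (Fin n)) (hu₀ : u₀ ∈ realSlice n)
    (δ : ℝ) (hδ : 0 < δ) :
    ∃ h : EuclideanSpace ℂ (Fin n) → ℂ, Differentiable ℂ h ∧ h u₀ = 0 ∧
      (∀ x ∈ realSlice n, ‖x - u₀‖ ≤ δ → ‖h x‖ ≤ 1 / 2) ∧
      (∀ x ∈ realSlice n, δ < ‖x - u₀‖ → 1 / 3 < ‖h x‖ ∧ ‖h x‖ < 1 / 2) := by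
  have key : ∀ x ∈ realSlice n, ∑ i, (x i - u₀ i) ^ 2 = ((‖x - u₀‖ ^ 2 : ℝ) : ℂ) := by
    intro x hx
    rw [EuclideanSpace.norm_sq_eq]
    push_cast
    refine Finset.sum_congr rfl fun i _ => ?_
    have him : (x i - u₀ i).im = 0 := by
      rw [Complex.sub_im, hx i, hu₀ i, sub_zero]
    have hre : x i - u₀ i = (((x i - u₀ i).re : ℝ) : ℂ) := by
      apply Complex.ext <;> simp [him] <;> simpa using him
    rw [PiLp.sub_apply, hre, Complex.norm_real, ← Complex.ofReal_pow, ← Complex.ofReal_pow,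
      Real.norm_eq_abs, sq_abs]
  have nrm : ∀ x ∈ realSlice n,
      ‖(1 / 2 : ℂ) * (1 - Complex.exp (-(((2 / δ ^ 2 : ℝ) : ℂ) * ∑ i, (x i - u₀ i) ^ 2)))‖
        = 1 / 2 * (1 - Real.exp (-(2 / δ ^ 2 * ‖x - u₀‖ ^ 2))) := by
    intro x hx
    rw [key x hx]
    have h1 : (1 / 2 : ℂ) * (1 - Complex.exp (-(((2 / δ ^ 2 : ℝ) : ℂ) *
        ((‖x - u₀‖ ^ 2 : ℝ) : ℂ)))) =
        ((1 / 2 * (1 - Real.exp (-(2 / δ ^ 2 * ‖x - u₀‖ ^ 2))) : ℝ) : ℂ) := by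
      push_cast
      ring
    rw [h1, Complex.norm_real, Real.norm_eq_abs, abs_of_nonneg]
    have h2 : Real.exp (-(2 / δ ^ 2 * ‖x - u₀‖ ^ 2)) ≤ 1 := by
      apply Real.exp_le_one_iff.mpr
      have : 0 ≤ 2 / δ ^ 2 * ‖x - u₀‖ ^ 2 := by positivity
      linarith
    linarith
  refine ⟨fun x => (1 / 2 : ℂ) *
    (1 - Complex.exp (-(((2 / δ ^ 2 : ℝ) : ℂ) * ∑ i, (x i - u₀ i) ^ 2))), ?_, ?_, ?_, ?_⟩
  · fun_prop
  · simp
  · intro x hx _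
    have := Real.exp_pos (-(2 / δ ^ 2 * ‖x - u₀‖ ^ 2))
    simp only [nrm x hx]
    linarith
  · intro x hx hlt
    have h0 := Real.exp_pos (-(2 / δ ^ 2 * ‖x - u₀‖ ^ 2))
    simp only [nrm x hx]
    have h1 : 2 ≤ 2 / δ ^ 2 * ‖x - u₀‖ ^ 2 := by
      rw [div_mul_eq_mul_div, le_div_iff₀ (by positivity)]
      have : δ ^ 2 ≤ ‖x - u₀‖ ^ 2 := by gcongr
      linarith
    have h2 : Real.exp (-(2 / δ ^ 2 * ‖x - u₀‖ ^ 2)) ≤ Real.exp (-2) :=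
      Real.exp_le_exp.mpr (by linarith)
    have h3 : Real.exp (-2) < 1 / 3 := by
      rw [Real.exp_neg, ← one_div]
      have := Real.add_one_lt_exp (x := 2) (by norm_num)
      apply one_div_lt_one_div_of_lt <;> linarith
    constructor <;> linarith
end
end
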